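/- Let j(R n R^{-1}) = e^{2πiχ} ∈ U(1) be a constant cocycle value and E = exp(2πi D) a diagonal unitary r×r matrix with D real diagonal. If q : H → C is holomorphic and satisfies q(w) = q(w + iλ₀e₁) · e^{2πi(tr_I D + (k+|I|)χ)} for all w ∈ H (where tr_I D := Σ_{j∈I} d_j for I ⊂ {1,...,r}), then q has a Fourier expansion q(w) = Σ_m c_m(w₂) e^{2πm w₁} with m ranging over (1/λ₀)(Z - tr_I D - (k+|I|)χ), with entire coefficients c_m, absolutely and locally uniformly convergent, and the coefficients are unique. -/

import Mathlib

open scoped Real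
noncomputable section

lemma aux_nhd {m : ℕ} {H : Set (ℂ × (Fin m → ℂ))} (hHo : IsOpen H) {g : ℂ × (Fin m → ℂ) → ℂ}
    (hg : DifferentiableOn ℂ g H) (γ : ℝ → ℂ) (hγ : Continuous γ) (v0 : Fin m → ℂ)
    (hin : ∀ t, (γ t, v0) ∈ H) :
    ∃ δ > 0, ∃ M, 0 ≤ M ∧ ∀ t ∈ Set.Icc (0:ℝ) 1, ∀ z v, dist z (γ t) ≤ δ → dist v v0 ≤ δ →
      (z, v) ∈ H ∧ ‖g (z, v)‖ ≤ M := by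
  have hK : IsCompact ((fun t => (γ t, v0)) '' Set.Icc (0:ℝ) 1) :=
    isCompact_Icc.image (by fun_prop)
  have hKH : ((fun t => (γ t, v0)) '' Set.Icc (0:ℝ) 1) ⊆ H := by
    rintro _ ⟨t, -, rfl⟩; exact hin t
  obtain ⟨δ, hδ, hsub⟩ := hK.exists_cthickening_subset_open hHo hKH
  obtain ⟨M, hM⟩ := (hK.cthickening (r := δ)).exists_bound_of_continuousOn
    (hg.continuousOn.mono hsub)
  refine ⟨δ, hδ, max M 0, le_max_right _ _, fun t ht z v hz hv => ?_⟩
  have : (z, v) ∈ Metric.cthickening δ ((fun t => (γ t, v0)) '' Set.Icc (0:ℝ) 1) := by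
    refine Metric.mem_cthickening_of_dist_le _ (γ t, v0) _ _ ⟨t, ht, rfl⟩ ?_
    rw [Prod.dist_eq]; exact max_le hz hv
  exact ⟨hsub this, (hM _ this).trans (le_max_left _ _)⟩

lemma aux_diff {m : ℕ} {H : Set (ℂ × (Fin m → ℂ))} (hHo : IsOpen H) {g : ℂ × (Fin m → ℂ) → ℂ}
    (hg : DifferentiableOn ℂ g H) (γ : ℝ → ℂ) (hγ : Continuous γ) (v0 : Fin m → ℂ)
    (hin : ∀ t, (γ t, v0) ∈ H) :
    DifferentiableAt ℂ (fun v => ∫ t in (0:ℝ)..1, g (γ t, v)) v0 := by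
  obtain ⟨δ, hδ, M, hM0, hM⟩ := aux_nhd hHo hg γ hγ v0 hin
  have hI : ∀ t ∈ Set.uIoc (0:ℝ) 1, t ∈ Set.Icc (0:ℝ) 1 := by
    intro t ht
    rw [Set.uIoc_of_le zero_le_one] at ht
    exact ⟨ht.1.le, ht.2⟩
  have hcont : ∀ v, dist v v0 ≤ δ → ContinuousOn (fun t => g (γ t, v)) (Set.Icc (0:ℝ) 1) := by
    intro v hv
    refine hg.continuousOn.comp (t := H) (by fun_prop) ?_
    intro t ht
    exact (hM t ht (γ t) v (by simpa using hδ.le) hv).1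
  have hdiff : ∀ t ∈ Set.Icc (0:ℝ) 1, ∀ v, dist v v0 ≤ δ →
      HasFDerivAt (fun v => g (γ t, v))
        ((fderiv ℂ g (γ t, v)).comp (ContinuousLinearMap.inr ℂ ℂ (Fin m → ℂ))) v := by
    intro t ht v hv
    have h1 := (hM t ht (γ t) v (by simpa using hδ.le) hv).1
    have h2 := (hg.differentiableAt (hHo.mem_nhds h1)).hasFDerivAt
    exact h2.comp v (hasFDerivAt_prodMk_right (γ t) v)
  have key := intervalIntegral.hasFDerivAt_integral_of_dominated_of_fderiv_le
    (𝕜 := ℂ) (μ := MeasureTheory.volume) (a := 0) (b := 1)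
    (F := fun v t => g (γ t, v))
    (F' := fun v t => (fderiv ℂ g (γ t, v)).comp (ContinuousLinearMap.inr ℂ ℂ (Fin m → ℂ)))
    (x₀ := v0) (s := Metric.ball v0 (δ/2)) (bound := fun _ => (2 * M) / (δ/2))
    (Metric.ball_mem_nhds _ (by positivity)) ?_ ?_ ?_ ?_ ?_ ?_
  · exact key.differentiableAt
  · filter_upwards [Metric.ball_mem_nhds v0 hδ] with v hv
    refine ((hcont v (le_of_lt hv)).mono hI).aestronglyMeasurable measurableSet_uIoc
  · refine ContinuousOn.intervalIntegrable ?_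
    rw [Set.uIcc_of_le zero_le_one]
    exact hcont v0 (by simpa using hδ.le)
  · refine Measurable.aestronglyMeasurable ?_
    have h1 : Measurable (fderiv ℂ g) := measurable_fderiv ℂ g
    have h2 : Measurable (fun t : ℝ => fderiv ℂ g (γ t, v0)) :=
      h1.comp (by fun_prop : Continuous fun t : ℝ => (γ t, v0)).measurable
    have h3 : Continuous (fun L : (ℂ × (Fin m → ℂ)) →L[ℂ] ℂ =>
      L.comp (ContinuousLinearMap.inr ℂ ℂ (Fin m → ℂ))) := by fun_prop
    exact h3.measurable.comp h2
  · refine Filter.Eventually.of_forall fun t ht v hv => ?_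
    have hv' : dist v v0 < δ / 2 := hv
    rw [← (hdiff t (hI t ht) v (by linarith)).fderiv]
    refine Complex.norm_fderiv_le_div_of_mapsTo_ball ?_ ?_ (by positivity)
    · intro u hu
      have hu' : dist u v < δ / 2 := hu
      refine (hdiff t (hI t ht) u ?_).differentiableAt.differentiableWithinAt
      linarith [dist_triangle u v v0]
    · intro u hu
      have hu' : dist u v < δ / 2 := hu
      have h1 := (hM t (hI t ht) (γ t) u (by simpa using hδ.le)
        (by linarith [dist_triangle u v v0])).2
      have h2 := (hM t (hI t ht) (γ t) v (by simpa using hδ.le) (by linarith)).2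
      rw [Metric.mem_closedBall, dist_eq_norm]
      linarith [norm_sub_le (g (γ t, u)) (g (γ t, v))]
  · simp
  · refine Filter.Eventually.of_forall fun t ht v hv => ?_
    have hv' : dist v v0 < δ / 2 := hv
    exact hdiff t (hI t ht) v (by linarith)

lemma aux_indep {g : ℂ → ℂ} {s lam : ℝ} (hlam : lam ≠ 0)
    (hg : ∀ z : ℂ, s < z.re → DifferentiableAt ℂ g z)
    (hper : ∀ z : ℂ, s < z.re → g (z + Complex.I * lam) = g z) (z1 z2 : ℂ)
    (h1 : s < z1.re) (h2 : s < z2.re) :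
    ∫ t in (0:ℝ)..1, g (z1 + Complex.I * lam * t) = ∫ t in (0:ℝ)..1, g (z2 + Complex.I * lam * t) := by
  have hl : (lam : ℂ) ≠ 0 := by exact_mod_cast hlam
  have hreal : ∀ z : ℂ, s < z.re → ∫ t in (0:ℝ)..1, g (z + Complex.I * lam * t) =
      ∫ t in (0:ℝ)..1, g ((z.re : ℂ) + Complex.I * lam * t) := by
    intro z hz
    have hp : Function.Periodic (fun t : ℝ => g ((z.re : ℂ) + Complex.I * lam * t)) 1 := by
      intro t
      have := hper ((z.re : ℂ) + Complex.I * lam * t) (by simpa using hz)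
      simp only
      rw [← this]
      congr 1
      push_cast
      ring
    have h := hp.intervalIntegral_add_eq (z.im / lam) 0
    rw [zero_add] at h
    rw [← h, add_comm (z.im / lam) 1]
    have h3 := intervalIntegral.integral_comp_add_right (a := 0) (b := 1)
      (fun t : ℝ => g ((z.re : ℂ) + Complex.I * lam * t)) (z.im / lam)
    rw [zero_add] at h3
    rw [← h3]
    congr 1
    ext t
    congr 1
    conv_lhs => rw [← Complex.re_add_im z]
    push_cast
    field_simp
    ring
  rw [hreal z1 h1, hreal z2 h2]
  generalize z1.re = x1 at h1
  generalize z2.re = x2 at h2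
  have hR := Complex.integral_boundary_rect_eq_zero_of_differentiableOn (fun ζ => g (lam * ζ))
    ((x1 / lam : ℝ) : ℂ) ((x2 / lam : ℝ) + Complex.I) ?_
  · simp only [Complex.ofReal_re, Complex.ofReal_im, Complex.add_re, Complex.add_im, Complex.I_re,
      Complex.I_im, add_zero, zero_add] at hR
    have hmem : ∀ u ∈ Set.uIcc (x1 / lam) (x2 / lam), s < lam * u := by
      intro u hu
      have h3 : lam * u ∈ (fun u => lam * u) '' Set.uIcc (x1 / lam) (x2 / lam) := ⟨u, hu, rfl⟩
      rw [Set.image_const_mul_uIcc] at h3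
      rw [mul_div_cancel₀ _ hlam, mul_div_cancel₀ _ hlam] at h3
      rcases Set.mem_uIcc.1 h3 with h | h <;> linarith [h.1]
    have hcanc : (∫ x : ℝ in (x1 / lam)..(x2 / lam), g (lam * (x + (0:ℝ) * Complex.I))) =
        ∫ x : ℝ in (x1 / lam)..(x2 / lam), g (lam * (x + (1:ℝ) * Complex.I)) := by
      refine intervalIntegral.integral_congr ?_
      intro u hu
      have := hper (lam * (u + (0:ℝ) * Complex.I)) (by simpa using hmem u hu)
      simp only
      rw [← this]
      congr 1
      push_cast
      ring
    rw [hcanc, sub_self, zero_add, sub_eq_zero] at hR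
    have hR' := smul_right_injective ℂ Complex.I_ne_zero hR
    have e : ∀ x : ℝ, ∀ y : ℝ, (lam : ℂ) * ((x / lam : ℝ) + y * Complex.I) = x + Complex.I * lam * y := by
      intro x y
      push_cast
      field_simp
    simp only [e] at hR'
    exact hR'.symm
  · intro ζ hζ
    rw [Complex.mem_reProdIm] at hζ
    simp only [Complex.ofReal_re, Complex.ofReal_im, Complex.add_re, Complex.add_im, Complex.I_re,
      Complex.I_im, add_zero, zero_add] at hζ
    have h3 : lam * ζ.re ∈ (fun u => lam * u) '' Set.uIcc (x1 / lam) (x2 / lam) := ⟨_, hζ.1, rfl⟩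
    rw [Set.image_const_mul_uIcc] at h3
    rw [mul_div_cancel₀ _ hlam, mul_div_cancel₀ _ hlam] at h3
    have h4 : s < ((lam : ℂ) * ζ).re := by
      rw [Complex.re_ofReal_mul]
      rcases Set.mem_uIcc.1 h3 with h | h <;> linarith [h.1]
    exact ((hg _ h4).comp ζ (by fun_prop)).differentiableWithinAt

lemma aux_summable (r C α lam : ℝ) (hr : 0 < r) (hlam : lam ≠ 0) :
    Summable (fun j : ℤ => C * Real.exp (- (r * |2 * π * (((j:ℝ) - α) / lam)|))) := by
  refine Summable.mul_left _ ?_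
  set b := r * (2 * π) / |lam| with hb
  have hb0 : 0 < b := by positivity
  have h1 : Summable (fun j : ℤ => Real.exp (b * |α|) * Real.exp (-b) ^ j.natAbs) := by
    refine Summable.mul_left _ ?_
    have hg : Summable (fun n : ℕ => Real.exp (-b) ^ n) :=
      summable_geometric_of_lt_one (Real.exp_pos _).le (by simpa using hb0)
    refine Summable.of_nat_of_neg ?_ ?_ <;> simpa using hg
  refine Summable.of_nonneg_of_le (fun _ => (Real.exp_pos _).le) (fun j => ?_) h1
  rw [← Real.exp_nat_mul, ← Real.exp_add]
  apply Real.exp_le_exp.2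
  have h2 : r * |2 * π * (((j:ℝ) - α) / lam)| = b * |(j:ℝ) - α| := by
    rw [abs_mul, abs_div, abs_of_pos (by positivity : 0 < 2 * π), hb]
    ring
  have h3 : ((j.natAbs : ℕ) : ℝ) = |(j:ℝ)| := by
    rw [Nat.cast_natAbs]; simp
  rw [h2, h3]
  have h4 := abs_sub_abs_le_abs_sub (j:ℝ) α
  nlinarith

lemma aux_fourier {f : ℝ → ℂ} (hf : Continuous f) (hp : Function.Periodic f 1) (a : ℤ → ℂ)
    (ha : ∀ j : ℤ, a j = ∫ t in (0:ℝ)..1, f t * Complex.exp (-(2 * π * Complex.I * j * t)))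
    (hs : Summable a) : f 0 = ∑' j, a j := by
  let F : C(UnitAddCircle, ℂ) := ⟨hp.lift, continuous_coinduced_dom.mpr hf⟩
  have hF : ∀ t : ℝ, F (t : UnitAddCircle) = f t := fun t => rfl
  have hc : fourierCoeff F = a := by
    ext j
    rw [fourierCoeff_eq_intervalIntegral _ _ 0, ha j]
    simp only [zero_add, div_one, one_smul, smul_eq_mul]
    refine intervalIntegral.integral_congr fun t _ => ?_
    simp only [hF, fourier_coe_apply]
    rw [mul_comm]
    congr 2
    push_cast
    ring
  have h := has_pointwise_sum_fourier_series_of_summable (f := F) (by rw [hc]; exact hs)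
    ((0:ℝ) : UnitAddCircle)
  rw [hF, hc] at h
  rw [← h.tsum_eq]
  refine tsum_congr fun j => ?_
  rw [fourier_coe_apply]
  simp

lemma aux_int (n : ℤ) : ∫ t in (0:ℝ)..1, Complex.exp (2 * π * Complex.I * n * t) =
    if n = 0 then 1 else 0 := by
  split_ifs with h
  · subst h; simp
  · have hc : (2 * π * Complex.I * n : ℂ) ≠ 0 := by
      have : (n:ℂ) ≠ 0 := by exact_mod_cast h
      exact mul_ne_zero Complex.two_pi_I_ne_zero this
    rw [integral_exp_mul_complex hc]
    have : Complex.exp (2 * π * Complex.I * n) = 1 := by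
      rw [mul_comm]; exact Complex.exp_int_mul_two_pi_mul_I n
    simp [this]

lemma aux_uniq (a : ℤ → ℂ) (ha : Summable fun j => ‖a j‖) (f : ℝ → ℂ)
    (hf : ∀ t : ℝ, f t = ∑' j : ℤ, a j * Complex.exp (2 * π * Complex.I * j * t)) (k : ℤ) :
    ∫ t in (0:ℝ)..1, f t * Complex.exp (-(2 * π * Complex.I * k * t)) = a k := by
  have hn : ∀ (j : ℤ) (t : ℝ), ‖Complex.exp (2 * π * Complex.I * j * t)‖ = 1 := by
    intro j t
    rw [show (2 * π * Complex.I * j * t : ℂ) = ((2 * π * j * t : ℝ) : ℂ) * Complex.I by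
      push_cast; ring]
    exact Complex.norm_exp_ofReal_mul_I _
  have h := intervalIntegral.hasSum_integral_of_dominated_convergence
    (μ := MeasureTheory.volume) (a := 0) (b := 1)
    (F := fun (j : ℤ) (t : ℝ) => a j * Complex.exp (2 * π * Complex.I * (j - k : ℤ) * t))
    (f := fun t : ℝ => f t * Complex.exp (-(2 * π * Complex.I * k * t)))
    (bound := fun j _ => ‖a j‖) ?_ ?_ ?_ ?_ ?_
  · rw [← h.tsum_eq]
    simp only [intervalIntegral.integral_const_mul, aux_int]
    rw [tsum_eq_single k]
    · simp
    · intro j hj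
      rw [if_neg (sub_ne_zero.2 hj), mul_zero]
  · intro j
    refine Continuous.aestronglyMeasurable ?_
    fun_prop
  · intro j
    refine Filter.Eventually.of_forall fun t _ => ?_
    rw [norm_mul, hn, mul_one]
  · exact Filter.Eventually.of_forall fun t _ => ha
  · simp
  · refine Filter.Eventually.of_forall fun t _ => ?_
    have hs : Summable (fun j : ℤ => a j * Complex.exp (2 * π * Complex.I * j * t)) := by
      refine Summable.of_norm ?_
      simpa only [norm_mul, hn, mul_one] using ha
    rw [hf t]
    have hfun : (fun j : ℤ => a j * Complex.exp (2 * π * Complex.I * (j - k : ℤ) * t)) =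
        fun j : ℤ => a j * Complex.exp (2 * π * Complex.I * j * t) *
          Complex.exp (-(2 * π * Complex.I * k * t)) := by
      funext j
      rw [mul_assoc (a j), ← Complex.exp_add]
      congr 2
      push_cast
      ring
    rw [hfun]
    exact hs.hasSum.mul_right _

theorem stmt_19 (m : ℕ) (hm : 1 ≤ m) (r : ℕ) (D : Fin r → ℝ)
    (I : Finset (Fin r)) (χ : ℝ) (k : ℤ) (lam0 : ℝ) (hlam0 : lam0 ≠ 0)
    (H : Set (ℂ × (Fin m → ℂ)))
    (hH : H = {w | w.1.re > (∑ j, ‖w.2 j‖ ^ 2) / 2})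
    (q : ℂ × (Fin m → ℂ) → ℂ) (hq : DifferentiableOn ℂ q H)
    (α : ℝ) (hα : α = (∑ j ∈ I, D j) + ((k : ℝ) + I.card) * χ)
    (hper : ∀ w ∈ H,
      q w = q (w.1 + Complex.I * (lam0 : ℂ), w.2) *
        Complex.exp (2 * (π : ℂ) * Complex.I * (α : ℂ))) :
    ∃! c : ℤ → (Fin m → ℂ) → ℂ,
      (∀ j : ℤ, Differentiable ℂ (c j)) ∧
      (∀ w ∈ H,
        Summable (fun j : ℤ =>
          ‖c j w.2 * Complex.exp ((2 * π * (((j : ℝ) - α) / lam0) : ℝ) * w.1)‖) ∧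
        q w = ∑' j : ℤ,
          c j w.2 * Complex.exp ((2 * π * (((j : ℝ) - α) / lam0) : ℝ) * w.1)) ∧
      TendstoLocallyUniformlyOn
        (fun s : Finset ℤ => fun w : ℂ × (Fin m → ℂ) => ∑ j ∈ s,
          c j w.2 * Complex.exp ((2 * π * (((j : ℝ) - α) / lam0) : ℝ) * w.1))
        q Filter.atTop H := by
  have hlc : (lam0 : ℂ) ≠ 0 := by exact_mod_cast hlam0
  obtain ⟨S, hS⟩ : ∃ S : (Fin m → ℂ) → ℝ, S = fun v => (∑ j, ‖v j‖ ^ 2) / 2 := ⟨_, rfl⟩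
  have hSc : Continuous S := by rw [hS]; fun_prop
  have hHm : ∀ z v, (z, v) ∈ H ↔ S v < z.re := by
    intro z v; rw [hH, hS]; rfl
  have hHo : IsOpen H := by
    have : H = {w | S w.2 < w.1.re} := by ext ⟨z, v⟩; exact hHm z v
    rw [this]
    exact isOpen_lt (by fun_prop) (Complex.continuous_re.comp continuous_fst)
  obtain ⟨mu, hmu⟩ : ∃ mu : ℤ → ℝ, mu = fun j : ℤ => 2 * π * (((j : ℝ) - α) / lam0) := ⟨_, rfl⟩
  have hmul : ∀ j, (mu j : ℂ) * lam0 = 2 * π * (j - α) := by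
    intro j; rw [hmu]; push_cast; field_simp
  have hmue : ∀ j : ℤ, 2 * π * (((j : ℝ) - α) / lam0) = mu j := fun j => by rw [hmu]
  simp only [hmue]
  obtain ⟨g, hg⟩ : ∃ g : ℤ → ℂ × (Fin m → ℂ) → ℂ,
    g = fun j w => q w * Complex.exp (-(mu j * w.1)) := ⟨_, rfl⟩
  have hgd : ∀ j, DifferentiableOn ℂ (g j) H := by
    intro j; rw [hg]
    exact hq.mul (by fun_prop)
  have hgper : ∀ j z v, S v < z.re → g j (z + Complex.I * lam0, v) = g j (z, v) := by
    intro j z v hz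
    rw [hg]
    simp only
    rw [hper (z, v) ((hHm z v).2 hz), mul_assoc, ← Complex.exp_add]
    congr 1
    rw [Complex.exp_eq_exp_iff_exists_int]
    refine ⟨-j, ?_⟩
    have := hmul j
    push_cast
    linear_combination (-Complex.I) * this
  have hindep : ∀ j v z1 z2, S v < z1.re → S v < z2.re →
      ∫ t in (0:ℝ)..1, g j (z1 + Complex.I * lam0 * t, v) =
        ∫ t in (0:ℝ)..1, g j (z2 + Complex.I * lam0 * t, v) := by
    intro j v z1 z2 h1 h2
    refine aux_indep (g := fun z => g j (z, v)) (s := S v) hlam0 ?_ ?_ z1 z2 h1 h2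
    · intro z hz
      have h3 := (hgd j).differentiableAt (hHo.mem_nhds ((hHm z v).2 hz))
      exact h3.comp z (by fun_prop : DifferentiableAt ℂ (fun z => (z, v)) z)
    · intro z hz; exact hgper j z v hz
  have hline : ∀ (z : ℂ) (t : ℝ), (z + Complex.I * lam0 * t).re = z.re := by
    intro z t; simp
  obtain ⟨c, hc⟩ : ∃ c : ℤ → (Fin m → ℂ) → ℂ, c = fun j v =>
    ∫ t in (0:ℝ)..1, g j (((S v + 1 : ℝ) : ℂ) + Complex.I * lam0 * t, v) := ⟨_, rfl⟩
  have hcz : ∀ j v z, S v < z.re → c j v = ∫ t in (0:ℝ)..1, g j (z + Complex.I * lam0 * t, v) := by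
    intro j v z hz
    rw [hc]
    exact hindep j v _ z (by rw [Complex.ofReal_re]; linarith) hz
  -- relation between g and the twisted periodic function
  have hrel : ∀ (j : ℤ) z v (t : ℝ), q (z + Complex.I * lam0 * t, v) *
      Complex.exp (2 * π * Complex.I * α * t) * Complex.exp (-(2 * π * Complex.I * j * t)) =
      g j (z + Complex.I * lam0 * t, v) * Complex.exp (mu j * z) := by
    intro j z v t
    rw [hg]
    simp only
    rw [mul_assoc (q _), mul_assoc (q _), ← Complex.exp_add, ← Complex.exp_add]
    congr 2
    have := hmul j
    linear_combination (Complex.I * t) * this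
  have hcoef : ∀ (j : ℤ) z v, S v < z.re → ∫ t in (0:ℝ)..1, q (z + Complex.I * lam0 * t, v) *
      Complex.exp (2 * π * Complex.I * α * t) * Complex.exp (-(2 * π * Complex.I * j * t)) =
      c j v * Complex.exp (mu j * z) := by
    intro j z v hz
    simp only [hrel]
    rw [intervalIntegral.integral_mul_const, hcz j v z hz]
  have hcd : ∀ j, Differentiable ℂ (c j) := by
    intro j v0
    have h1 := aux_diff hHo (hgd j) (fun t => ((S v0 + 1 : ℝ) : ℂ) + Complex.I * lam0 * t)
      (by fun_prop) v0 (fun t => (hHm _ _).2 (by rw [hline, Complex.ofReal_re]; linarith))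
    refine h1.congr_of_eventuallyEq ?_
    have h2 : ∀ᶠ v in nhds v0, S v < S v0 + 1 :=
      hSc.continuousAt.eventually_lt continuousAt_const (by linarith)
    filter_upwards [h2] with v hv
    exact hcz j v _ (by rw [Complex.ofReal_re]; exact hv)
  have hcb : ∀ j v (x M : ℝ), S v < x →
      (∀ t ∈ Set.Icc (0:ℝ) 1, ‖q ((x:ℂ) + Complex.I * lam0 * t, v)‖ ≤ M) →
      ‖c j v‖ ≤ M * Real.exp (-(mu j * x)) := by
    intro j v x M hx hM
    rw [hcz j v x (by simpa using hx)]
    have := intervalIntegral.norm_integral_le_of_norm_le_const (a := 0) (b := 1)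
      (C := M * Real.exp (-(mu j * x)))
      (f := fun t : ℝ => g j ((x:ℂ) + Complex.I * lam0 * t, v)) ?_
    · simpa using this
    · intro t ht
      rw [Set.uIoc_of_le zero_le_one] at ht
      rw [hg]
      simp only
      rw [norm_mul, Complex.norm_exp]
      have h3 : (-((mu j : ℂ) * ((x:ℂ) + Complex.I * lam0 * t))).re = -(mu j * x) := by
        rw [Complex.neg_re, Complex.re_ofReal_mul, hline, Complex.ofReal_re]
      rw [h3]
      gcongr
      exact hM t ⟨ht.1.le, ht.2⟩
  have hloc : ∀ w ∈ H, ∃ U ∈ nhds w, ∃ u : ℤ → ℝ, Summable u ∧ ∀ j, ∀ w' ∈ U,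
      ‖c j w'.2 * Complex.exp (mu j * w'.1)‖ ≤ u j := by
    rintro ⟨z, v⟩ hw
    have hw' := (hHm z v).1 hw
    obtain ⟨δ, hδ, M, hM0, hM⟩ := aux_nhd hHo hq
      (fun t => ((z.re : ℝ) : ℂ) + Complex.I * lam0 * t) (by fun_prop) v
      (fun t => (hHm _ _).2 (by rw [hline, Complex.ofReal_re]; exact hw'))
    refine ⟨Metric.ball (z, v) (δ / 2), Metric.ball_mem_nhds _ (by positivity), _,
      aux_summable (δ / 2) M α lam0 (by positivity) hlam0, ?_⟩
    rintro j ⟨z', v'⟩ hball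
    rw [Metric.mem_ball, Prod.dist_eq, max_lt_iff] at hball
    obtain ⟨hz', hv'⟩ := hball
    have hre : |z'.re - z.re| < δ / 2 := by
      rw [dist_eq_norm] at hz'
      exact (Complex.abs_re_le_norm (z' - z)).trans_lt hz'
    have hdist : ∀ e : ℝ, |e| ≤ δ / 2 → ∀ t ∈ Set.Icc (0:ℝ) 1,
        (((z'.re + e : ℝ) : ℂ) + Complex.I * lam0 * t, v') ∈ H ∧
        ‖q (((z'.re + e : ℝ) : ℂ) + Complex.I * lam0 * t, v')‖ ≤ M := by
      intro e he t ht
      refine hM t ht _ _ ?_ (by simp only at hv'; linarith)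
      rw [dist_eq_norm, add_sub_add_right_eq_sub, ← Complex.ofReal_sub, Complex.norm_real,
        Real.norm_eq_abs]
      rw [abs_le] at he ⊢
      rw [abs_lt] at hre
      constructor <;> linarith [he.1, he.2, hre.1, hre.2]
    have hb : ∀ e : ℝ, |e| ≤ δ / 2 → ‖c j v'‖ ≤ M * Real.exp (-(mu j * (z'.re + e))) := by
      intro e he
      refine hcb j v' _ M ?_ (fun t ht => (hdist e he t ht).2)
      have := (hHm _ _).1 (hdist e he 0 (by simp)).1
      rwa [hline, Complex.ofReal_re] at this
    rw [hmue, norm_mul, Complex.norm_exp, Complex.re_ofReal_mul]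
    obtain ⟨e, he, hee⟩ : ∃ e : ℝ, |e| ≤ δ / 2 ∧ mu j * e = δ / 2 * |mu j| := by
      rcases le_total 0 (mu j) with h | h
      · refine ⟨δ / 2, by rw [abs_of_pos (by positivity)], by rw [abs_of_nonneg h]; ring⟩
      · refine ⟨-(δ / 2), by rw [abs_neg, abs_of_pos (by positivity)], by
          rw [abs_of_nonpos h]; ring⟩
    calc ‖c j v'‖ * Real.exp (mu j * z'.re)
        ≤ M * Real.exp (-(mu j * (z'.re + e))) * Real.exp (mu j * z'.re) := by
          gcongr; exact hb e he
      _ = M * Real.exp (-(δ / 2 * |mu j|)) := by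
          rw [mul_assoc, ← Real.exp_add, ← hee]; congr 2; ring
  have hsum : ∀ w ∈ H, Summable (fun j : ℤ => ‖c j w.2 * Complex.exp (mu j * w.1)‖) := by
    intro w hw
    obtain ⟨U, hU, u, hu, hb⟩ := hloc w hw
    exact Summable.of_nonneg_of_le (fun _ => norm_nonneg _)
      (fun j => hb j w (mem_of_mem_nhds hU)) hu
  have heq : ∀ w ∈ H, q w = ∑' j : ℤ, c j w.2 * Complex.exp (mu j * w.1) := by
    rintro ⟨z, v⟩ hw
    have hw' := (hHm z v).1 hw
    have hin : ∀ t : ℝ, (z + Complex.I * lam0 * t, v) ∈ H := fun t =>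
      (hHm _ _).2 (by rw [hline]; exact hw')
    have h := aux_fourier (f := fun t : ℝ => q (z + Complex.I * lam0 * t, v) *
      Complex.exp (2 * π * Complex.I * α * t)) ?_ ?_
      (fun j => c j v * Complex.exp (mu j * z)) (fun j => (hcoef j z v hw').symm)
      (hsum (z, v) hw).of_norm
    · simpa using h
    · refine Continuous.mul ?_ (by fun_prop)
      exact hq.continuousOn.comp_continuous (by fun_prop) hin
    · intro t
      have h1 := hper _ (hin t)
      simp only at h1 ⊢
      rw [h1, mul_assoc (q _), ← Complex.exp_add]
      congr 2
      · congr 1; push_cast; ring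
      · push_cast; ring
  refine ⟨c, ⟨hcd, fun w hw => ⟨hsum w hw, heq w hw⟩, ?_⟩, ?_⟩
  · refine tendstoLocallyUniformlyOn_of_forall_exists_nhds ?_
    intro w hw
    obtain ⟨U, hU, u, hu, hb⟩ := hloc w hw
    refine ⟨U ∩ H, Filter.inter_mem (mem_nhdsWithin_of_mem_nhds hU) self_mem_nhdsWithin, ?_⟩
    refine (tendstoUniformlyOn_tsum hu (fun j w' hw' => hb j w' hw'.1)).congr_right ?_
    intro w' hw'
    exact (heq w' hw'.2).symm
  · rintro c' ⟨-, hc', -⟩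
    funext j v
    have hz : S v < ((S v + 1 : ℝ) : ℂ).re := by rw [Complex.ofReal_re]; linarith
    have hexp : ∀ (i : ℤ) (t : ℝ), Complex.exp (mu i * (((S v + 1 : ℝ) : ℂ) + Complex.I * lam0 * t)) *
        Complex.exp (2 * π * Complex.I * α * t) = Complex.exp (mu i * ((S v + 1 : ℝ) : ℂ)) *
        Complex.exp (2 * π * Complex.I * i * t) := by
      intro i t
      rw [← Complex.exp_add, ← Complex.exp_add]
      congr 1
      have := hmul i
      linear_combination (Complex.I * t) * this
    have h := aux_uniq (fun i => c' i v * Complex.exp (mu i * ((S v + 1 : ℝ) : ℂ)))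
      (hc' (((S v + 1 : ℝ) : ℂ), v) ((hHm _ _).2 hz)).1
      (fun t : ℝ => q (((S v + 1 : ℝ) : ℂ) + Complex.I * lam0 * t, v) *
        Complex.exp (2 * π * Complex.I * α * t)) ?_ j
    · rw [hcoef j _ v hz] at h
      exact (mul_right_cancel₀ (Complex.exp_ne_zero _) h).symm
    · intro t
      rw [(hc' (((S v + 1 : ℝ) : ℂ) + Complex.I * lam0 * t, v)
        ((hHm _ _).2 (by rw [hline]; exact hz))).2, ← tsum_mul_right]
      refine tsum_congr fun i => ?_
      rw [mul_assoc (c' i v), hexp, mul_assoc (c' i v)]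

end
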